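/- For any α > 0, σ > 0 and z ∈ ℝ, if the GAGA update map f(b) = α(σ+b)²/(z² + σ + b) has no fixed point in [0, ∞), then the GAGA hyperparameter sequence b_0 = 0, b_{k+1} = f(b_k) tends to +∞ as k → ∞. -/

import Mathlib

open Filter

/-- The scalar GAGA hyperparameter recursion: `b₀ = 0`,
`b_{k+1} = α (σ + b_k)² / (z² + σ + b_k)`. -/
noncomputable def gagaB (α σ z : ℝ) : ℕ → ℝ
  | 0 => 0
  | k + 1 => α * (σ + gagaB α σ z k) ^ 2 / (z ^ 2 + σ + gagaB α σ z k)

/-- The GAGA update map is monotone on `[0, ∞)`. -/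
theorem gaga_update_monotoneOn (α σ z : ℝ) (hα : 0 < α) (hσ : 0 < σ) :
    MonotoneOn (fun b : ℝ => α * (σ + b) ^ 2 / (z ^ 2 + σ + b)) (Set.Ici 0) := by
  intro x hx y hy hxy
  rw [Set.mem_Ici] at hx hy
  have hz : 0 ≤ z ^ 2 := sq_nonneg z
  have hs : 0 < σ + x := by linarith
  have ht : 0 < σ + y := by linarith
  change α * (σ + x) ^ 2 / (z ^ 2 + σ + x) ≤ α * (σ + y) ^ 2 / (z ^ 2 + σ + y)
  rw [div_le_div_iff₀ (by linarith) (by linarith)]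
  have h₁ : 0 ≤ z ^ 2 * ((y - x) * ((σ + x) + (σ + y))) :=
    mul_nonneg hz (mul_nonneg (by linarith) (by linarith))
  have h₂ : 0 ≤ (σ + x) * (σ + y) * (y - x) :=
    mul_nonneg (mul_pos hs ht).le (by linarith)
  have h₃ := mul_nonneg hα.le (add_nonneg h₁ h₂)
  linarith

theorem gagaB_nonneg (α σ z : ℝ) (hα : 0 < α) (hσ : 0 < σ) (k : ℕ) :
    0 ≤ gagaB α σ z k := by
  induction k with
  | zero => exact le_rfl
  | succ k ih =>
    rw [gagaB]
    positivity

theorem gagaB_monotone (α σ z : ℝ) (hα : 0 < α) (hσ : 0 < σ) :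
    Monotone (gagaB α σ z) := by
  refine monotone_nat_of_le_succ fun k => ?_
  induction k with
  | zero => exact gagaB_nonneg α σ z hα hσ 1
  | succ k ih =>
    exact gaga_update_monotoneOn α σ z hα hσ (gagaB_nonneg α σ z hα hσ k)
      (gagaB_nonneg α σ z hα hσ (k + 1)) ih

/-- If the GAGA update map has no fixed point in `[0, ∞)`, then the GAGA hyperparameter
sequence tends to `+∞`. -/
theorem gaga_diverges_of_no_fixed_point (α σ z : ℝ) (hα : 0 < α) (hσ : 0 < σ)
    (hfix : ¬ ∃ b : ℝ, 0 ≤ b ∧ α * (σ + b) ^ 2 / (z ^ 2 + σ + b) = b) :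
    Tendsto (gagaB α σ z) atTop atTop := by
  rcases tendsto_atTop_of_monotone (gagaB_monotone α σ z hα hσ) with h | ⟨l, hl⟩
  · exact h
  · have hl0 : 0 ≤ l := ge_of_tendsto' hl (gagaB_nonneg α σ z hα hσ)
    have hden : z ^ 2 + σ + l ≠ 0 := by positivity
    have hstep : Tendsto (fun k => gagaB α σ z (k + 1)) atTop
        (nhds (α * (σ + l) ^ 2 / (z ^ 2 + σ + l))) :=
      (((hl.const_add σ).pow 2).const_mul α).div (hl.const_add (z ^ 2 + σ)) hden
    exact absurd ⟨l, hl0, tendsto_nhds_unique hstep (hl.comp (tendsto_add_atTop_nat 1))⟩ hfix
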